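/- arXiv:2301.11209 — 9 statements merged into one kernel-verified Lean document; each statement's English description precedes it below -/
import Mathlib

section
/- Let a ∈ (0,1] and let α ≥ 2π be a real number. Define f_α'(x) = (log(x+a))^(α−1)·(α − log(x+a))/(x+a)² and f_α''(x) = (log(x+a))^(α−2)/(x+a)³ · (α(α−1) − 3α·log(x+a) + 2·log²(x+a)). Define C_α(a) = (log(1+a))^α/(1+a) − (log(1+a))^(α+1)/(α+1) − (log(1+a))^α/(2(1+a)) − (1/12)·f_α'(1) − ∫₁^∞ P₂(x)·f_α''(x) dx. Then |C_α(a)| < α² + (3/4)·α²·(log α)·exp(α·Re(log w(α/(2π)) − 1/w(α/(2π)))), where log denotes the principal complex logarithm. -/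
open Real

lemma cos_mul_le_sin {v : ℝ} (h0 : 0 ≤ v) (h1 : v ≤ π / 2) :
    (v + v ^ 3 / 3) * cos v ≤ sin v := by
  have hv : v ≤ 2 := h1.trans (by linarith [pi_le_four])
  have hs := sin_ge_sub_cube (x := v) h0
  have hs2 := sin_ge_sub_cube (x := v / 2) (by linarith)
  have hc : cos v = 1 - 2 * sin (v / 2) ^ 2 := by
    have := cos_two_mul (v / 2)
    rw [show 2 * (v / 2) = v by ring] at this
    rw [this]; linarith [sin_sq_add_cos_sq (v / 2)]
  have hq : 0 ≤ v / 2 - (v / 2) ^ 3 / 6 := by nlinarith [mul_nonneg h0 h0, mul_nonneg h0 (mul_nonneg h0 h0)]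
  have hsq : (v / 2 - (v / 2) ^ 3 / 6) ^ 2 ≤ sin (v / 2) ^ 2 := by gcongr
  have hc' : cos v ≤ 1 - v ^ 2 / 2 + v ^ 4 / 24 := by
    rw [hc]; nlinarith [sq_nonneg (v ^ 3)]
  have h3 : 0 ≤ v + v ^ 3 / 3 := by positivity
  calc _ ≤ (v + v ^ 3 / 3) * (1 - v ^ 2 / 2 + v ^ 4 / 24) := by gcongr
    _ ≤ v - v ^ 3 / 6 := by
      have : 0 ≤ v ^ 5 * (9 - v ^ 2) := by
        have : 0 ≤ 9 - v ^ 2 := by nlinarith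
        positivity
      nlinarith
    _ ≤ _ := hs

/-- Cartesian form of the equation `w * exp w = I * t` at `w = u + I * v`. -/
structure IsSaddle (t u v : ℝ) : Prop where
  t_pos : 0 < t
  v_pos : 0 < v
  v_lt : v < π / 2
  re_eq : u * cos v = v * sin v
  im_eq : exp u * (u * sin v + v * cos v) = t

lemma isSaddle_of_lambert {t : ℝ} {w : ℂ} (ht : 0 < t) (h0 : 0 < w.im) (h1 : w.im < π / 2)
    (h : w * Complex.exp w = Complex.I * t) : IsSaddle t w.re w.im := by
  have hre := congrArg Complex.re h
  have him := congrArg Complex.im h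
  simp only [Complex.mul_re, Complex.mul_im, Complex.exp_re, Complex.exp_im, Complex.I_re,
    Complex.I_im, Complex.ofReal_re, Complex.ofReal_im] at hre him
  refine ⟨ht, h0, h1, ?_, by linarith⟩
  have : exp w.re * (w.re * cos w.im - w.im * sin w.im) = 0 := by linarith
  rcases mul_eq_zero.1 this with h | h
  · exact absurd h (exp_pos _).ne'
  · linarith

namespace IsSaddle

variable {t u v : ℝ}

lemma cos_pos (h : IsSaddle t u v) : 0 < cos v :=
  cos_pos_of_mem_Ioo ⟨by linarith [h.v_pos, pi_pos], h.v_lt⟩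

lemma sin_pos (h : IsSaddle t u v) : 0 < sin v :=
  sin_pos_of_pos_of_lt_pi h.v_pos (by linarith [h.v_lt, pi_pos])

lemma u_pos (h : IsSaddle t u v) : 0 < u := by
  have := mul_pos h.v_pos h.sin_pos
  rw [← h.re_eq] at this
  exact pos_of_mul_pos_left this h.cos_pos.le

lemma sq_add_le (h : IsSaddle t u v) : v ^ 2 + v ^ 4 / 3 ≤ u := by
  have h1 := mul_le_mul_of_nonneg_left (cos_mul_le_sin h.v_pos.le h.v_lt.le) h.v_pos.le
  rw [← h.re_eq] at h1
  refine le_of_mul_le_mul_right (a := cos v) ?_ h.cos_pos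
  linarith

lemma sq_eq (h : IsSaddle t u v) : t ^ 2 = (u ^ 2 + v ^ 2) * exp u ^ 2 := by
  rw [← h.im_eq]
  linear_combination exp u ^ 2 * (u ^ 2 + v ^ 2) * sin_sq_add_cos_sq v
    - exp u ^ 2 * (u * cos v - v * sin v) * h.re_eq

lemma sin_div (h : IsSaddle t u v) : sin v / t = u / (u ^ 2 + v ^ 2) * exp (-u) := by
  have hs : u ^ 2 + v ^ 2 ≠ 0 := by nlinarith [h.u_pos, h.v_pos]
  rw [exp_neg]
  have := h.t_pos.ne'
  have := (exp_pos u).ne'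
  field_simp
  rw [← h.im_eq]
  linear_combination (- exp u * v) * h.re_eq

end IsSaddle

lemma exp_neg_ge_of_le {u δ : ℝ} (hu : 2 ≤ u) (h0 : 0 ≤ δ) (h1 : δ ≤ u) :
    δ ^ 2 / 2 ≤ u * (exp (-δ) - 1 + δ) := by
  rcases le_total δ 2 with h | h
  · have h2 := add_one_le_exp (-(δ / 2))
    have h3 : (1 - δ / 2) ^ 2 ≤ exp (-(δ / 2)) ^ 2 := by gcongr <;> linarith
    rw [← exp_nat_mul] at h3
    have h4 : ((2 : ℕ) : ℝ) * -(δ / 2) = -δ := by push_cast; ring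
    rw [h4] at h3
    have : δ ^ 2 / 4 ≤ exp (-δ) - 1 + δ := by linarith
    nlinarith [sq_nonneg δ]
  · have := exp_pos (-δ)
    have h2 : δ / 2 ≤ exp (-δ) - 1 + δ := by linarith
    nlinarith

lemma log_one_sub_le {y : ℝ} (h0 : 0 ≤ y) (h1 : y < 1) : log (1 - y) ≤ -y - y ^ 2 / 2 := by
  have h := hasSum_pow_div_log_of_abs_lt_one (x := y) (by rwa [abs_of_nonneg h0])
  have h2 := sum_le_hasSum (Finset.range 2) (fun n _ => by positivity) h
  norm_num [Finset.sum_range_succ] at h2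
  linarith

lemma one_sub_exp_neg_le {δ : ℝ} (h0 : 0 ≤ δ) : 1 - exp (-δ) ≤ δ - δ ^ 2 / 2 + δ ^ 3 / 6 := by
  have hd : ∀ x : ℝ, HasDerivAt (fun x => exp x * (1 - x + x ^ 2 / 2 - x ^ 3 / 6))
      (- (exp x * x ^ 3 / 6)) x := by
    intro x
    have h := (hasDerivAt_exp x).mul (((((hasDerivAt_const x (1 : ℝ)).sub (hasDerivAt_id x)).add
      ((hasDerivAt_pow 2 x).div_const 2)).sub ((hasDerivAt_pow 3 x).div_const 6)))
    convert! h using 1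
    simp
    ring
  have hanti : AntitoneOn (fun x => exp x * (1 - x + x ^ 2 / 2 - x ^ 3 / 6)) (Set.Ici 0) := by
    refine antitoneOn_of_deriv_nonpos (convex_Ici 0)
      (fun x _ => (hd x).continuousAt.continuousWithinAt)
      (fun x _ => (hd x).differentiableAt.differentiableWithinAt) fun x hx => ?_
    rw [interior_Ici, Set.mem_Ioi] at hx
    rw [(hd x).deriv]
    have : 0 ≤ exp x * x ^ 3 / 6 := by positivity
    linarith
  have h := hanti (Set.mem_Ici.2 le_rfl) (Set.mem_Ici.2 h0) h0
  simp only [exp_zero] at h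
  have h2 := mul_le_mul_of_nonneg_left h (exp_pos (-δ)).le
  have h3 : exp (-δ) * exp δ = 1 := by rw [← exp_add]; simp
  have h4 : exp (-δ) * (exp δ * (1 - δ + δ ^ 2 / 2 - δ ^ 3 / 6))
      = 1 - δ + δ ^ 2 / 2 - δ ^ 3 / 6 := by rw [← mul_assoc, h3, one_mul]
  rw [h4] at h2
  linarith

/-- On a horizontal line through a saddle, the modulus is maximal at the saddle. -/
lemma half_log_sub_le {u v x : ℝ} (hu0 : 0 < u) (hu : 3 / 2 ≤ u ^ 2) (hv : v ^ 2 ≤ u)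
    (hv0 : 0 < v) (hx : 0 ≤ x) :
    log (x ^ 2 + v ^ 2) / 2 - u / (u ^ 2 + v ^ 2) * exp (x - u)
      ≤ log (u ^ 2 + v ^ 2) / 2 - u / (u ^ 2 + v ^ 2) := by
  have hu1 : 1 ≤ u := by nlinarith
  obtain ⟨s, hs⟩ : ∃ s, s = u ^ 2 + v ^ 2 := ⟨_, rfl⟩
  have hspos : 0 < s := by rw [hs]; positivity
  have hxs : 0 < x ^ 2 + v ^ 2 := by positivity
  have hlog : log (x ^ 2 + v ^ 2) = log s + log (1 - (u ^ 2 - x ^ 2) / s) := by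
    rw [← log_mul hspos.ne']
    · congr 1; field_simp; rw [hs]; ring
    · have : 1 - (u ^ 2 - x ^ 2) / s = (x ^ 2 + v ^ 2) / s := by field_simp; rw [hs]; ring
      rw [this]; positivity
  have hpos1 : 0 < 1 - (u ^ 2 - x ^ 2) / s := by
    have : 1 - (u ^ 2 - x ^ 2) / s = (x ^ 2 + v ^ 2) / s := by field_simp; rw [hs]; ring
    rw [this]; positivity
  have hsq : 0 ≤ s := hspos.le
  rw [← hs, hlog]
  have hlin : log (1 - (u ^ 2 - x ^ 2) / s) ≤ -((u ^ 2 - x ^ 2) / s) := by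
    have := log_le_sub_one_of_pos hpos1
    linarith
  have key : ∀ L, log (1 - (u ^ 2 - x ^ 2) / s) ≤ L →
      s * L / 2 + u - u * exp (x - u) ≤ 0 →
      (log s + log (1 - (u ^ 2 - x ^ 2) / s)) / 2 - u / s * exp (x - u) ≤ log s / 2 - u / s := by
    intro L h1 h2
    have h3 : (s * L / 2 + u - u * exp (x - u)) / s ≤ 0 := div_nonpos_of_nonpos_of_nonneg h2 hsq
    have h4 : (s * L / 2 + u - u * exp (x - u)) / s = L / 2 + u / s - u / s * exp (x - u) := by
      field_simp
    linarith
  rcases le_total u x with hux | hux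
  · refine key _ hlin ?_
    have h1 := quadratic_le_exp_of_nonneg (x := x - u) (by linarith)
    have h2 : s * -((u ^ 2 - x ^ 2) / s) / 2 = (x ^ 2 - u ^ 2) / 2 := by field_simp; ring
    rw [h2]
    nlinarith [mul_le_mul_of_nonneg_left h1 hu0.le, mul_nonneg (sub_nonneg.2 hu1) (sq_nonneg (x - u))]
  · have hE : exp (x - u) = exp (-(u - x)) := by congr 1; ring
    rcases le_total 2 u with h2u | h2u
    · refine key _ hlin ?_
      have h1 := exp_neg_ge_of_le (u := u) (δ := u - x) h2u (by linarith) (by linarith)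
      have h2 : s * -((u ^ 2 - x ^ 2) / s) / 2 = (x ^ 2 - u ^ 2) / 2 := by field_simp; ring
      rw [h2, hE]
      nlinarith
    · have hy0 : 0 ≤ (u ^ 2 - x ^ 2) / s := div_nonneg (by nlinarith) hsq
      refine key _ (log_one_sub_le hy0 (by linarith)) ?_
      rw [hE]
      obtain ⟨δ, hδ⟩ : ∃ δ, δ = u - x := ⟨_, rfl⟩
      have hδ0 : 0 ≤ δ := by linarith
      have hδu : δ ≤ u := by linarith
      have hx : x = u - δ := by linarith
      rw [← hδ, hx]
      have h1 : δ - δ ^ 2 / 2 + δ ^ 3 / 6 ≥ 1 - exp (-δ) := one_sub_exp_neg_le hδ0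
      have h3 : s * (-((u ^ 2 - (u - δ) ^ 2) / s) - ((u ^ 2 - (u - δ) ^ 2) / s) ^ 2 / 2) / 2
          = - (δ * (2 * u - δ)) / 2 - δ ^ 2 * (2 * u - δ) ^ 2 / (4 * s) := by
        field_simp; ring
      rw [h3]
      have hsu : s ≤ u * (u + 1) := by nlinarith
      have h4 : u / (4 * (u + 1)) ≤ (2 * u - δ) ^ 2 / (4 * s) := by
        rw [div_le_div_iff₀ (by positivity) (by positivity)]
        have : u ^ 2 ≤ (2 * u - δ) ^ 2 := by gcongr; linarith
        calc u * (4 * s) ≤ u * (4 * (u * (u + 1))) := by gcongr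
          _ = u ^ 2 * (4 * (u + 1)) := by ring
          _ ≤ _ := by gcongr
      have h5 : 1 / 2 + u ^ 2 / 6 ≤ u / 2 + u / (4 * (u + 1)) := by
        have : u / 2 + u / (4 * (u + 1)) - (1 / 2 + u ^ 2 / 6)
            = (2 - u) * (2 * u ^ 2 - 3) / (12 * (u + 1)) := by field_simp; ring
        have : 0 ≤ (2 - u) * (2 * u ^ 2 - 3) / (12 * (u + 1)) :=
          div_nonneg (mul_nonneg (by linarith) (by linarith)) (by linarith)
        linarith
      have h6 : 0 ≤ δ ^ 2 * (u / 2 + (2 * u - δ) ^ 2 / (4 * s) - 1 / 2 - u * δ / 6) := by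
        apply mul_nonneg (sq_nonneg _)
        nlinarith
      have h7 : δ ^ 2 * (2 * u - δ) ^ 2 / (4 * s) = δ ^ 2 * ((2 * u - δ) ^ 2 / (4 * s)) := by ring
      rw [h7]
      nlinarith [mul_le_mul_of_nonneg_left h1 hu0.le]

lemma half_log_arc_le {τ x y V : ℝ} (hτ0 : 0 ≤ τ) (hτ : τ ≤ 9 / 50) (hx0 : 0 ≤ x)
    (hx : x ≤ log 2) (hy : 0 ≤ y) (hyV : y ≤ V) (hV : V ≤ π / 2) :
    log (x ^ 2 + y ^ 2) / 2 - τ * (exp x * sin y)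
      ≤ max 0 (log (x ^ 2 + V ^ 2) / 2 - τ * (exp x * sin V)) := by
  have hsin : 0 ≤ sin y := sin_nonneg_of_nonneg_of_le_pi hy (by linarith [pi_pos])
  have hx2 : x ≤ 0.6931471808 := hx.trans log_two_lt_d9.le
  have hV2 : V ≤ 1.58 := by linarith [pi_lt_d2]
  rcases le_total (x ^ 2 + y ^ 2) 1 with h | h
  · refine le_max_of_le_left ?_
    have h1 : log (x ^ 2 + y ^ 2) ≤ 0 := log_nonpos (by positivity) h
    have h2 : 0 ≤ τ * (exp x * sin y) := by positivity
    linarith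
  · refine le_max_of_le_right ?_
    have hy1 : 0.72 ≤ y := by nlinarith
    have hex : exp x ≤ 2 := by
      rw [← exp_log (show (0 : ℝ) < 2 by norm_num)]; exact exp_le_exp.2 hx
    have hsV : sin V - sin y ≤ V - y := by
      have := abs_sin_sub_sin_le V y
      rw [abs_of_nonneg (sub_nonneg.2 hyV)] at this
      exact (le_abs_self _).trans this
    have h1 : τ * (exp x * (sin V - sin y)) ≤ 9 / 50 * (2 * (V - y)) := by
      calc τ * (exp x * (sin V - sin y)) ≤ τ * (exp x * (V - y)) := by gcongr
        _ ≤ _ := by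
          have := sub_nonneg.2 hyV
          gcongr
    have hp : 0 < x ^ 2 + V ^ 2 := by nlinarith
    have hq : 0 < x ^ 2 + y ^ 2 := by linarith
    have h2 := log_le_sub_one_of_pos (div_pos hq hp)
    rw [log_div hq.ne' hp.ne'] at h2
    have h3 : (x ^ 2 + y ^ 2) / (x ^ 2 + V ^ 2) - 1 ≤ - (0.72 * (V - y)) := by
      rw [sub_le_iff_le_add, div_le_iff₀ hp]
      have h4 : 0.72 * (x ^ 2 + V ^ 2) ≤ V + y := by nlinarith
      nlinarith [mul_le_mul_of_nonneg_left h4 (sub_nonneg.2 hyV)]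
    linarith

namespace IsSaddle

variable {t u v : ℝ}

lemma norm_sq_le (h : IsSaddle t u v) : u ^ 2 + v ^ 2 ≤ u ^ 2 + 3 / 5 * u + 1 / 5 := by
  nlinarith [h.sq_add_le, sq_nonneg (v ^ 2 - 1)]

lemma le_u (h : IsSaddle t u v) (ht : 18 / π ≤ t) : 1.26 ≤ u := by
  by_contra! hu
  have h1 : 5.729 ≤ t := by
    refine le_trans ?_ ht
    rw [le_div_iff₀ pi_pos]
    linarith [pi_lt_d4]
  have h2 : exp u ≤ 3.53 := by
    have h3 : exp u ≤ exp 1.26 := exp_le_exp.2 hu.le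
    have h4 : exp (1.26 : ℝ) = exp 1 * exp 0.26 := by rw [← exp_add]; norm_num
    have h5 := exp_bound' (x := 0.26) (by norm_num) (by norm_num) (n := 4) (by norm_num)
    norm_num [Finset.sum_range_succ, Nat.factorial] at h5
    have h6 := exp_one_lt_d9
    have h7 := exp_pos (0.26 : ℝ)
    rw [h4] at h3
    norm_num at h3 h5 h6 h7 ⊢
    nlinarith
  have h3 := h.sq_eq
  have h4 : (u ^ 2 + v ^ 2) ≤ 2.5436 := by
    have := h.norm_sq_le
    nlinarith [h.u_pos]
  have h5 : (u ^ 2 + v ^ 2) * exp u ^ 2 ≤ 2.5436 * 3.53 ^ 2 := by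
    have := exp_pos u
    gcongr
  have h6 : (5.729 : ℝ) ^ 2 ≤ t ^ 2 := by gcongr
  norm_num at *
  linarith

lemma log_sub_nonpos (h : IsSaddle t u v) (ht : t = 18 / π) :
    log (u ^ 2 + v ^ 2) / 2 - u / (u ^ 2 + v ^ 2) ≤ 0 := by
  have hu := h.le_u ht.ge
  have hu0 := h.u_pos
  have hs : 0 < u ^ 2 + v ^ 2 := by positivity
  have hl : log t = log (u ^ 2 + v ^ 2) / 2 + u := by
    have := congrArg log h.sq_eq
    rw [log_mul hs.ne' (by positivity), log_pow, log_pow, log_exp] at this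
    push_cast at this
    linarith
  have ht1 : log t ≤ 1.75 := by
    rw [log_le_iff_le_exp h.t_pos, ht, div_le_iff₀ pi_pos]
    have h4 : exp (1.75 : ℝ) = exp 1 * exp 0.75 := by rw [← exp_add]; norm_num
    have h5 := sum_le_exp_of_nonneg (x := 0.75) (by norm_num) 6
    norm_num [Finset.sum_range_succ, Nat.factorial] at h5
    have h6 := exp_one_gt_d9
    have h7 : (5.74 : ℝ) ≤ exp 1.75 := by
      rw [h4]
      norm_num at h5 h6 ⊢
      nlinarith
    nlinarith [pi_gt_d2]
  have h1 : u / (u ^ 2 + 3 / 5 * u + 1 / 5) ≤ u / (u ^ 2 + v ^ 2) := by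
    have := h.norm_sq_le
    gcongr
  have h2 : 1.75 - u ≤ u / (u ^ 2 + 3 / 5 * u + 1 / 5) := by
    rw [le_div_iff₀ (by positivity)]
    norm_num at hu ⊢
    nlinarith [mul_nonneg (sub_nonneg.2 hu) (sub_nonneg.2 hu)]
  linarith

end IsSaddle

/-- The quantity `Re (log w - 1 / w)`. -/
noncomputable def lambertRate (w : ℂ) : ℝ := (Complex.log w - 1 / w).re

lemma lambertRate_eq (w : ℂ) :
    lambertRate w = log (w.re ^ 2 + w.im ^ 2) / 2 - w.re / (w.re ^ 2 + w.im ^ 2) := by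
  have h : Complex.normSq w = w.re ^ 2 + w.im ^ 2 := by rw [Complex.normSq_apply]; ring
  rw [lambertRate, Complex.sub_re, Complex.log_re, one_div, Complex.inv_re, h, ← h,
    Complex.normSq_eq_norm_sq, log_pow]
  push_cast
  ring

lemma IsSaddle.phase_le {t u v x y : ℝ} (h : IsSaddle t u v) (ht : 18 / π ≤ t) (hx : 0 ≤ x)
    (hxy : y = v ∨ x ≤ log 2 ∧ 0 ≤ y ∧ y ≤ v) :
    log (x ^ 2 + y ^ 2) / 2 - 1 / t * (exp x * sin y)
      ≤ max 0 (log (u ^ 2 + v ^ 2) / 2 - u / (u ^ 2 + v ^ 2)) := by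
  have hu := h.le_u ht
  have hline : log (x ^ 2 + v ^ 2) / 2 - 1 / t * (exp x * sin v)
      ≤ log (u ^ 2 + v ^ 2) / 2 - u / (u ^ 2 + v ^ 2) := by
    have h1 := half_log_sub_le (u := u) (v := v) h.u_pos (by norm_num at hu ⊢; nlinarith)
      (by nlinarith [h.sq_add_le, sq_nonneg (v ^ 2)]) h.v_pos hx
    have h2 : 1 / t * (exp x * sin v) = u / (u ^ 2 + v ^ 2) * exp (x - u) := by
      rw [sub_eq_add_neg x u, exp_add]
      linear_combination exp x * h.sin_div
    rwa [h2]
  rcases hxy with rfl | ⟨hx2, hy0, hyv⟩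
  · exact hline.trans (le_max_right _ _)
  · have hτ : 1 / t ≤ 9 / 50 := by
      have : (50 : ℝ) / 9 ≤ t := by
        refine le_trans ?_ ht
        rw [le_div_iff₀ pi_pos]
        linarith [pi_lt_d2]
      rw [div_le_iff₀ h.t_pos]
      linarith
    refine (half_log_arc_le (one_div_pos.2 h.t_pos).le hτ hx hx2 hy0 hyv h.v_lt.le).trans ?_
    exact max_le_max le_rfl hline

/-- A contour height on which the integrand is controlled by its value at the saddle. -/
lemma exists_contour {α : ℝ} (hα : 0 < α) {w : ℝ → ℂ}
    (hw : ∀ t : ℝ, 0 < t → 0 < (w t).im ∧ (w t).im < π / 2 ∧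
      w t * Complex.exp (w t) = Complex.I * t) :
    ∃ V, 0 < V ∧ V < π / 2 ∧ ∀ x y, 0 ≤ x → (y = V ∨ x ≤ log 2 ∧ 0 ≤ y ∧ y ≤ V) →
      exp (α * (log (x ^ 2 + y ^ 2) / 2) - 2 * π * (exp x * sin y))
        ≤ 1 + exp (α * lambertRate (w (α / (2 * π)))) := by
  have hs : ∀ t, 0 < t → IsSaddle t (w t).re (w t).im := fun t ht =>
    isSaddle_of_lambert ht (hw t ht).1 (hw t ht).2.1 (hw t ht).2.2
  obtain ⟨β, hβ⟩ : ∃ β, β = max α 36 := ⟨_, rfl⟩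
  have hαβ : α ≤ β := hβ ▸ le_max_left _ _
  have h36 : 36 ≤ β := hβ ▸ le_max_right _ _
  have ht : 0 < β / (2 * π) := by positivity
  have ht18 : 18 / π ≤ β / (2 * π) := by
    rw [div_le_div_iff₀ pi_pos (by positivity)]
    nlinarith [pi_pos]
  have h := hs _ ht
  refine ⟨_, h.v_pos, h.v_lt, fun x y hx hxy => ?_⟩
  have hm := h.phase_le ht18 hx hxy
  have hE := exp_pos (α * lambertRate (w (α / (2 * π))))
  have hsin : 0 ≤ sin y := by
    have h1 : 0 ≤ y ∧ y ≤ (w (β / (2 * π))).im := by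
      rcases hxy with rfl | ⟨-, h0, h1⟩
      · exact ⟨h.v_pos.le, le_rfl⟩
      · exact ⟨h0, h1⟩
    exact sin_nonneg_of_nonneg_of_le_pi h1.1 (by linarith [h1.2, h.v_lt, pi_pos])
  have hτ : 2 * π = β * (1 / (β / (2 * π))) := by field_simp
  have hle : α * (log (x ^ 2 + y ^ 2) / 2) - 2 * π * (exp x * sin y)
      ≤ α * max 0 (lambertRate (w (β / (2 * π)))) := by
    rw [lambertRate_eq]
    refine le_trans ?_ (mul_le_mul_of_nonneg_left hm hα.le)
    have : α * (1 / (β / (2 * π)) * (exp x * sin y)) ≤ 2 * π * (exp x * sin y) := by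
      have hZ : 0 ≤ 1 / (β / (2 * π)) * (exp x * sin y) := by positivity
      calc _ ≤ β * (1 / (β / (2 * π)) * (exp x * sin y)) := by gcongr
        _ = _ := by rw [← mul_assoc, ← hτ]
    linarith
  refine (exp_le_exp.2 hle).trans ?_
  rcases le_total (lambertRate (w (β / (2 * π)))) 0 with h0 | h0
  · rw [max_eq_left h0, mul_zero, exp_zero]
    linarith
  · rcases le_total α 36 with h1 | h1
    · have hβ36 : β = 36 := by rw [hβ, max_eq_right h1]
      have := h.log_sub_nonpos (by rw [hβ36]; field_simp; norm_num)
      rw [← lambertRate_eq] at this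
      rw [max_eq_left this, mul_zero, exp_zero]
      linarith
    · have hβα : β = α := by rw [hβ, max_eq_left h1]
      rw [max_eq_right h0, hβα]
      linarith

/-- The function `exp w * f (exp w - a)`, where `f x = f_α'' x`. -/
noncomputable def stieltjesKernel (α : ℝ) (w : ℂ) : ℂ :=
  w ^ ((α - 2 : ℝ) : ℂ) * Complex.exp (-2 * w) *
    ((α : ℂ) * (α - 1) - 3 * α * w + 2 * w ^ 2)

/-- The function `exp (2πik x) f_α'' x dx` in the variable `w = log (x + a)`. -/
noncomputable def oscKernel (α a : ℝ) (k : ℕ) (w : ℂ) : ℂ :=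
  Complex.exp (2 * π * k * Complex.I * (Complex.exp w - a)) * stieltjesKernel α w

lemma norm_stieltjesKernel_le {α : ℝ} (hα : 2 ≤ α) (w : ℂ) :
    ‖stieltjesKernel α w‖ ≤ (α ^ 2 + 2 * α + 2) * (max 1 (‖w‖ ^ α) * exp (-2 * w.re)) := by
  have hpoly : ‖(α : ℂ) * (α - 1) - 3 * α * w + 2 * w ^ 2‖
      ≤ α * (α - 1) + 3 * α * ‖w‖ + 2 * ‖w‖ ^ 2 := by
    refine (norm_add_le _ _).trans (add_le_add ((norm_sub_le _ _).trans (add_le_add ?_ ?_)) ?_)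
    · rw [← Complex.ofReal_one, ← Complex.ofReal_sub, ← Complex.ofReal_mul, Complex.norm_real,
        norm_of_nonneg (by nlinarith)]
    · rw [norm_mul, norm_mul, Complex.norm_real, norm_of_nonneg (by linarith)]
      norm_num
    · rw [norm_mul, norm_pow]
      norm_num
  have hexp : ‖Complex.exp (-2 * w)‖ = exp (-2 * w.re) := by
    rw [Complex.norm_exp]; simp
  have hr := norm_nonneg w
  have hmain : ‖w‖ ^ (α - 2) * (α * (α - 1) + 3 * α * ‖w‖ + 2 * ‖w‖ ^ 2)
      ≤ (α ^ 2 + 2 * α + 2) * max 1 (‖w‖ ^ α) := by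
    rcases le_total ‖w‖ 1 with h | h
    · have h1 : ‖w‖ ^ (α - 2) ≤ 1 := rpow_le_one hr h (by linarith)
      have h2 : α * (α - 1) + 3 * α * ‖w‖ + 2 * ‖w‖ ^ 2 ≤ α ^ 2 + 2 * α + 2 := by nlinarith
      have h3 : 0 ≤ α * (α - 1) + 3 * α * ‖w‖ + 2 * ‖w‖ ^ 2 := by
        have : 0 ≤ α - 1 := by linarith
        positivity
      calc _ ≤ 1 * (α ^ 2 + 2 * α + 2) := by gcongr
        _ = (α ^ 2 + 2 * α + 2) * 1 := by ring
        _ ≤ _ := by gcongr; exact le_max_left _ _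
    · have h2 : α * (α - 1) + 3 * α * ‖w‖ + 2 * ‖w‖ ^ 2 ≤ (α ^ 2 + 2 * α + 2) * ‖w‖ ^ 2 := by
        have ha : 0 ≤ α * (α - 1) := by nlinarith
        have h1 : 1 ≤ ‖w‖ ^ 2 := by nlinarith
        have h3 : ‖w‖ ≤ ‖w‖ ^ 2 := by nlinarith
        nlinarith [mul_le_mul_of_nonneg_left h1 ha]
      have h4 : ‖w‖ ^ (α - 2) * ‖w‖ ^ 2 = ‖w‖ ^ α := by
        rw [← rpow_natCast ‖w‖ 2, ← rpow_add (by linarith)]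
        norm_num
      calc _ ≤ ‖w‖ ^ (α - 2) * ((α ^ 2 + 2 * α + 2) * ‖w‖ ^ 2) := by gcongr
        _ = (α ^ 2 + 2 * α + 2) * ‖w‖ ^ α := by rw [← h4]; ring
        _ ≤ _ := by gcongr; exact le_max_right _ _
  rw [stieltjesKernel, norm_mul, norm_mul, Complex.norm_cpow_real, hexp]
  calc ‖w‖ ^ (α - 2) * exp (-2 * w.re) * ‖(α : ℂ) * (α - 1) - 3 * α * w + 2 * w ^ 2‖
      ≤ ‖w‖ ^ (α - 2) * exp (-2 * w.re) * (α * (α - 1) + 3 * α * ‖w‖ + 2 * ‖w‖ ^ 2) := by gcongr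
    _ = ‖w‖ ^ (α - 2) * (α * (α - 1) + 3 * α * ‖w‖ + 2 * ‖w‖ ^ 2) * exp (-2 * w.re) := by ring
    _ ≤ (α ^ 2 + 2 * α + 2) * max 1 (‖w‖ ^ α) * exp (-2 * w.re) := by gcongr
    _ = _ := by ring

lemma norm_oscKernel (α a : ℝ) (k : ℕ) (w : ℂ) :
    ‖oscKernel α a k w‖
      = exp (-(k * (2 * π * (exp w.re * sin w.im)))) * ‖stieltjesKernel α w‖ := by
  rw [oscKernel, norm_mul, Complex.norm_exp]
  congr 2
  have : 2 * (π : ℂ) * k * Complex.I * (Complex.exp w - a)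
      = ((2 * π * k : ℝ) : ℂ) * (Complex.I * (Complex.exp w - a)) := by push_cast; ring
  rw [this, Complex.re_ofReal_mul, Complex.I_mul_re, Complex.sub_im, Complex.exp_im,
    Complex.ofReal_im]
  ring

lemma norm_oscKernel_le {α a E : ℝ} {k : ℕ} {w : ℂ} (hα : 2 ≤ α) (hk : 1 ≤ k) (hE : 1 ≤ E)
    (hw : 0 < w.re) (hsin : 0 ≤ sin w.im)
    (h : exp (α * (log (w.re ^ 2 + w.im ^ 2) / 2) - 2 * π * (exp w.re * sin w.im)) ≤ E) :
    ‖oscKernel α a k w‖ ≤ (α ^ 2 + 2 * α + 2) * E * exp (-2 * w.re) := by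
  have hw0 : w ≠ 0 := by rintro rfl; simp at hw
  have hr : ‖w‖ ^ α = exp (α * (log (w.re ^ 2 + w.im ^ 2) / 2)) := by
    have : w.re ^ 2 + w.im ^ 2 = ‖w‖ ^ 2 := by
      rw [← Complex.normSq_eq_norm_sq, Complex.normSq_apply]; ring
    rw [this, log_pow, rpow_def_of_pos (norm_pos_iff.2 hw0)]
    push_cast
    ring_nf
  have hpos : 0 ≤ 2 * π * (exp w.re * sin w.im) := by positivity
  have hk' : (1 : ℝ) ≤ k := by exact_mod_cast hk
  have hosc : exp (-(k * (2 * π * (exp w.re * sin w.im))))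
      ≤ exp (-(2 * π * (exp w.re * sin w.im))) := exp_le_exp.2 (by nlinarith)
  have hmax : exp (-(2 * π * (exp w.re * sin w.im))) * max 1 (‖w‖ ^ α) ≤ E := by
    rw [mul_max_of_nonneg _ _ (exp_pos _).le, hr, ← exp_add, mul_one]
    refine max_le ((exp_le_one_iff.2 (by linarith)).trans hE) (le_trans (le_of_eq ?_) h)
    congr 1; ring
  rw [norm_oscKernel]
  calc _ ≤ exp (-(2 * π * (exp w.re * sin w.im))) *
        ((α ^ 2 + 2 * α + 2) * (max 1 (‖w‖ ^ α) * exp (-2 * w.re))) := by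
        gcongr; exact norm_stieltjesKernel_le hα w
    _ = (α ^ 2 + 2 * α + 2) * (exp (-(2 * π * (exp w.re * sin w.im))) * max 1 (‖w‖ ^ α))
        * exp (-2 * w.re) := by ring
    _ ≤ _ := by gcongr

lemma differentiableAt_oscKernel (α a : ℝ) (k : ℕ) {w : ℂ} (hw : 0 < w.re) :
    DifferentiableAt ℂ (oscKernel α a k) w := by
  have hs : w ∈ Complex.slitPlane := Or.inl hw
  unfold oscKernel stieltjesKernel
  have h1 : DifferentiableAt ℂ (fun w : ℂ => w ^ ((α - 2 : ℝ) : ℂ)) w :=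
    differentiableAt_id.cpow_const hs
  fun_prop

lemma norm_oscKernel_right_le {α a x y : ℝ} {k : ℕ} (hα : 2 ≤ α) (hx : 0 ≤ x) (hy : 0 ≤ y)
    (hy2 : y ≤ 2) : ‖oscKernel α a k (x + y * Complex.I)‖
      ≤ (α ^ 2 + 2 * α + 2) * ((x + 2) ^ α * exp (-2 * x)) := by
  have hre : ((x : ℂ) + y * Complex.I).re = x := by simp
  have him : ((x : ℂ) + y * Complex.I).im = y := by simp
  have hsin : 0 ≤ sin y := sin_nonneg_of_nonneg_of_le_pi hy (by linarith [pi_gt_three])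
  have hn : ‖(x : ℂ) + y * Complex.I‖ ≤ x + 2 := by
    refine (norm_add_le _ _).trans ?_
    rw [norm_mul, Complex.norm_real, Complex.norm_real, Complex.norm_I, norm_of_nonneg hx,
      norm_of_nonneg hy]
    linarith
  have hmax : max 1 (‖(x : ℂ) + y * Complex.I‖ ^ α) ≤ (x + 2) ^ α := by
    refine max_le (one_le_rpow (by linarith) (by linarith)) ?_
    gcongr
  have h := norm_stieltjesKernel_le hα ((x : ℂ) + y * Complex.I)
  rw [norm_oscKernel]
  rw [hre] at h ⊢
  rw [him]
  have h1 : exp (-(k * (2 * π * (exp x * sin y)))) ≤ 1 := by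
    apply exp_le_one_iff.2
    have : 0 ≤ (k * (2 * π * (exp x * sin y))) := by positivity
    linarith
  calc _ ≤ 1 * ‖stieltjesKernel α ((x : ℂ) + y * Complex.I)‖ := by gcongr
    _ ≤ _ := by
      rw [one_mul]
      refine h.trans ?_
      gcongr

lemma integral_exp_neg_two_mul_le {c R : ℝ} (hc : 0 ≤ c) :
    ∫ x in c..R, exp (-2 * x) ≤ 1 / 2 := by
  have : ∫ x in c..R, exp (-2 * x) = (exp (-2 * c) - exp (-2 * R)) / 2 := by
    rw [intervalIntegral.integral_comp_mul_left (fun x => exp x) (by norm_num : (-2 : ℝ) ≠ 0),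
      integral_exp, smul_eq_mul]
    ring
  rw [this]
  have h1 : exp (-2 * c) ≤ 1 := exp_le_one_iff.2 (by linarith)
  linarith [exp_pos (-2 * R)]

/-- Shifting the segment `[c, R]` to height `V`. -/
lemma norm_integral_oscKernel_le {α a c E V R : ℝ} {k : ℕ} (hα : 2 ≤ α) (hk : 1 ≤ k)
    (hE : 1 ≤ E) (hc : 0 < c) (hc2 : c ≤ log 2) (hV : 0 < V) (hV2 : V < π / 2) (hR : c ≤ R)
    (h : ∀ x y, 0 ≤ x → (y = V ∨ x ≤ log 2 ∧ 0 ≤ y ∧ y ≤ V) →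
      exp (α * (log (x ^ 2 + y ^ 2) / 2) - 2 * π * (exp x * sin y)) ≤ E) :
    ‖∫ x in c..R, oscKernel α a k x‖ ≤ (α ^ 2 + 2 * α + 2) * E * (1 / 2 + V)
      + (α ^ 2 + 2 * α + 2) * ((R + 2) ^ α * exp (-2 * R)) * V := by
  have hsin : ∀ y, 0 ≤ y → y ≤ V → 0 ≤ sin y := fun y h0 h1 =>
    sin_nonneg_of_nonneg_of_le_pi h0 (by linarith [pi_pos])
  have hD : 0 ≤ (α ^ 2 + 2 * α + 2) * E := by positivity
  have hrect := Complex.integral_boundary_rect_eq_zero_of_differentiableOn (oscKernel α a k)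
    (c : ℂ) (R + V * Complex.I) (by
      intro w hw
      refine (differentiableAt_oscKernel α a k ?_).differentiableWithinAt
      have h1 := hw.1
      simp only [Complex.ofReal_re, Complex.add_re, Complex.mul_re, Complex.I_re, mul_zero,
        Complex.ofReal_im, Complex.I_im, mul_one, sub_self, add_zero, Set.mem_preimage,
        Set.uIcc_of_le hR] at h1
      exact hc.trans_le h1.1)
  simp only [Complex.ofReal_re, Complex.add_re, Complex.mul_re, Complex.I_re, mul_zero,
    Complex.ofReal_im, Complex.I_im, mul_one, sub_self, add_zero, Complex.add_im, Complex.mul_im,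
    zero_add, Complex.ofReal_zero, zero_mul, smul_eq_mul] at hrect
  have htop : ‖∫ x in c..R, oscKernel α a k (x + V * Complex.I)‖
      ≤ (α ^ 2 + 2 * α + 2) * E * (1 / 2) := by
    have h1 : ‖∫ x in c..R, oscKernel α a k (x + V * Complex.I)‖
        ≤ ∫ x in c..R, (α ^ 2 + 2 * α + 2) * E * exp (-2 * x) := by
      refine intervalIntegral.norm_integral_le_of_norm_le hR ?_ (by
        apply Continuous.intervalIntegrable; fun_prop)
      refine Filter.Eventually.of_forall fun x hx => ?_
      have hx0 : 0 < x := hc.trans hx.1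
      have := norm_oscKernel_le (a := a) (w := x + V * Complex.I) hα hk hE (by simpa using hx0)
        (by simpa using hsin V hV.le le_rfl)
        (by simpa using h x V hx0.le (Or.inl rfl))
      simpa using this
    refine h1.trans ?_
    rw [intervalIntegral.integral_const_mul]
    gcongr
    exact integral_exp_neg_two_mul_le hc.le
  have hright : ‖∫ y in (0 : ℝ)..V, oscKernel α a k (R + y * Complex.I)‖
      ≤ (α ^ 2 + 2 * α + 2) * ((R + 2) ^ α * exp (-2 * R)) * V := by
    have := intervalIntegral.norm_integral_le_of_norm_le_const (a := 0) (b := V)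
      (f := fun y : ℝ => oscKernel α a k (R + y * Complex.I))
      (C := (α ^ 2 + 2 * α + 2) * ((R + 2) ^ α * exp (-2 * R))) (fun y hy => by
        rw [Set.uIoc_of_le hV.le] at hy
        exact norm_oscKernel_right_le hα (hc.le.trans hR) hy.1.le
          (by linarith [hy.2, pi_lt_four]))
    rwa [sub_zero, abs_of_pos hV] at this
  have hleft : ‖∫ y in (0 : ℝ)..V, oscKernel α a k (c + y * Complex.I)‖
      ≤ (α ^ 2 + 2 * α + 2) * E * V := by
    have := intervalIntegral.norm_integral_le_of_norm_le_const (a := 0) (b := V)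
      (f := fun y : ℝ => oscKernel α a k (c + y * Complex.I))
      (C := (α ^ 2 + 2 * α + 2) * E) (fun y hy => by
        rw [Set.uIoc_of_le hV.le] at hy
        have := norm_oscKernel_le (a := a) (w := c + y * Complex.I) hα hk hE (by simpa using hc)
          (by simpa using hsin y hy.1.le hy.2)
          (by simpa using h c y hc.le (Or.inr ⟨hc2, hy.1.le, hy.2⟩))
        refine this.trans ?_
        have : exp (-2 * ((c : ℂ) + y * Complex.I).re) ≤ 1 := by
          apply exp_le_one_iff.2; simp; linarith
        nlinarith)
    rwa [sub_zero, abs_of_pos hV] at this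
  have heq : ∫ x in c..R, oscKernel α a k x
      = (∫ x in c..R, oscKernel α a k (x + V * Complex.I))
        - Complex.I * (∫ y in (0 : ℝ)..V, oscKernel α a k (R + y * Complex.I))
        + Complex.I * (∫ y in (0 : ℝ)..V, oscKernel α a k (c + y * Complex.I)) := by
    linear_combination hrect
  rw [heq]
  refine (norm_add_le _ _).trans ?_
  refine (add_le_add (norm_sub_le _ _) le_rfl).trans ?_
  rw [norm_mul, norm_mul, Complex.norm_I, one_mul, one_mul]
  linarith

open MeasureTheory Filter Topology

lemma hasSum_fract_bernoulli (x : ℝ) :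
    HasSum (fun n : ℕ => 1 / (n : ℝ) ^ 2 * cos (2 * π * n * x))
      (π ^ 2 * (Int.fract x ^ 2 - Int.fract x + 1 / 6)) := by
  have h := hasSum_one_div_nat_pow_mul_cos one_ne_zero
    (x := Int.fract x) ⟨Int.fract_nonneg x, (Int.fract_lt_one x).le⟩
  convert! h using 1
  · ext n
    have : 2 * π * n * x = 2 * π * n * Int.fract x + ((n * ⌊x⌋ : ℤ) : ℝ) * (2 * π) := by
      rw [Int.fract]; push_cast; ring
    rw [this, cos_add_int_mul_two_pi, mul_one]
  · norm_num [Polynomial.bernoulli, Finset.sum_range_succ, Polynomial.eval_monomial, Nat.choose,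
      bernoulli, bernoulli'_two]
    ring

/-- A uniform bound on the Fourier integrals of `h` bounds its integral against `P₂`. -/
lemma abs_integral_fract_mul_le {h : ℝ → ℝ} {s : Set ℝ} {B : ℝ} (hh : IntegrableOn h s)
    (hB : ∀ k : ℕ, 1 ≤ k → |∫ x in s, cos (2 * π * k * x) * h x| ≤ B) :
    |∫ x in s, (Int.fract x ^ 2 - Int.fract x + 1 / 6) * h x| ≤ B / 6 := by
  have hint : ∀ n : ℕ, IntegrableOn (fun x => 1 / (n : ℝ) ^ 2 * cos (2 * π * n * x) * h x) s := by
    intro n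
    refine Integrable.bdd_mul (c := 1 / (n : ℝ) ^ 2) hh ?_ ?_
    · apply Continuous.aestronglyMeasurable; fun_prop
    · refine Eventually.of_forall fun x => ?_
      rw [norm_mul, norm_of_nonneg (by positivity)]
      exact mul_le_of_le_one_right (by positivity) (abs_cos_le_one _)
  have hsum : Summable fun n : ℕ => ∫ x in s, ‖1 / (n : ℝ) ^ 2 * cos (2 * π * n * x) * h x‖ := by
    refine Summable.of_nonneg_of_le (fun n => integral_nonneg fun x => norm_nonneg _) (fun n => ?_)
      ((hasSum_zeta_two.summable).mul_right (∫ x in s, ‖h x‖))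
    rw [← integral_const_mul]
    refine integral_mono (hint n).norm (hh.norm.const_mul _) fun x => ?_
    simp only [norm_mul]
    rw [norm_of_nonneg (show 0 ≤ 1 / (n : ℝ) ^ 2 by positivity)]
    gcongr
    exact mul_le_of_le_one_right (by positivity) (abs_cos_le_one _)
  have key := hasSum_integral_of_summable_integral_norm hint hsum
  have hts : ∀ x, ∑' n : ℕ, 1 / (n : ℝ) ^ 2 * cos (2 * π * n * x) * h x
      = π ^ 2 * ((Int.fract x ^ 2 - Int.fract x + 1 / 6) * h x) := fun x => by
    rw [((hasSum_fract_bernoulli x).mul_right (h x)).tsum_eq, mul_assoc]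
  simp only [hts, integral_const_mul] at key
  simp only [mul_assoc, integral_const_mul] at key
  have hle : |π ^ 2 * ∫ x in s, (Int.fract x ^ 2 - Int.fract x + 1 / 6) * h x|
      ≤ π ^ 2 / 6 * B := by
    rw [← key.tsum_eq, ← norm_eq_abs]
    refine tsum_of_norm_bounded (hasSum_zeta_two.mul_right B) fun n => ?_
    rw [norm_mul, norm_of_nonneg (show 0 ≤ 1 / (n : ℝ) ^ 2 by positivity)]
    rcases Nat.eq_zero_or_pos n with rfl | hn
    · simp
    · gcongr
      have := hB n hn
      simpa only [mul_assoc, norm_eq_abs] using this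
  rw [abs_mul, abs_of_pos (by positivity)] at hle
  have hpi : 0 < π ^ 2 := by positivity
  refine le_of_mul_le_mul_left (hle.trans_eq ?_) hpi
  ring

/-- `exp u * f (exp u - a)` on the real line, where `f x = f_α'' x`. -/
noncomputable def stieltjesKernelReal (α u : ℝ) : ℝ :=
  u ^ (α - 2) * exp (-2 * u) * (α * (α - 1) - 3 * α * u + 2 * u ^ 2)

lemma stieltjesKernel_ofReal (α : ℝ) {u : ℝ} (hu : 0 ≤ u) :
    stieltjesKernel α u = stieltjesKernelReal α u := by
  rw [stieltjesKernel, stieltjesKernelReal, ← Complex.ofReal_cpow hu]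
  push_cast
  ring

lemma cos_mul_stieltjesKernelReal (α a : ℝ) (k : ℕ) {u : ℝ} (hu : 0 ≤ u) :
    cos (2 * π * k * (exp u - a)) * stieltjesKernelReal α u = (oscKernel α a k u).re := by
  rw [oscKernel, stieltjesKernel_ofReal α hu, Complex.re_mul_ofReal]
  congr 1
  have : 2 * (π : ℂ) * k * Complex.I * (Complex.exp u - a)
      = ((2 * π * k * (exp u - a) : ℝ) : ℂ) * Complex.I := by push_cast; ring
  rw [this, Complex.exp_ofReal_mul_I_re]

lemma tendsto_rpow_mul_exp_atTop (α : ℝ) :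
    Tendsto (fun R : ℝ => (R + 2) ^ α * exp (-2 * R)) atTop (𝓝 0) := by
  have h := (tendsto_rpow_mul_exp_neg_mul_atTop_nhds_zero α 2 two_pos).comp
    (tendsto_atTop_add_const_right atTop (2 : ℝ) tendsto_id)
  have h2 := h.mul_const (exp 4)
  rw [zero_mul] at h2
  refine h2.congr fun R => ?_
  simp only [Function.comp, id]
  rw [mul_assoc, ← exp_add]
  congr 2
  ring

lemma continuous_stieltjesKernelReal {α : ℝ} (hα : 2 ≤ α) :
    Continuous (stieltjesKernelReal α) := by
  unfold stieltjesKernelReal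
  have : Continuous fun u : ℝ => u ^ (α - 2) := continuous_rpow_const (by linarith)
  fun_prop

lemma integrableOn_stieltjesKernelReal {α : ℝ} (hα : 2 ≤ α) (c : ℝ) :
    IntegrableOn (stieltjesKernelReal α) (Set.Ioi c) := by
  refine integrable_of_isBigO_exp_neg (b := 1) one_pos
    (continuous_stieltjesKernelReal hα).continuousOn ?_
  have hlim : Tendsto (fun R : ℝ => R ^ α * exp (-1 * R)) atTop (𝓝 0) :=
    tendsto_rpow_mul_exp_neg_mul_atTop_nhds_zero α 1 one_pos
  refine Asymptotics.IsBigO.of_bound (α ^ 2 + 2 * α + 2) ?_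
  filter_upwards [eventually_ge_atTop 1, hlim.eventually_le_const one_pos] with u hu hu1
  have h := norm_stieltjesKernel_le hα (u : ℂ)
  have hu0 : 0 ≤ u := by linarith
  rw [stieltjesKernel_ofReal α hu0, Complex.norm_real, Complex.norm_real, Complex.ofReal_re,
    norm_of_nonneg hu0, max_eq_right (one_le_rpow hu (by linarith))] at h
  refine h.trans ?_
  rw [norm_of_nonneg (exp_pos _).le]
  gcongr
  calc u ^ α * exp (-2 * u) = u ^ α * exp (-1 * u) * exp (-1 * u) := by
        rw [mul_assoc, ← exp_add]; ring_nf
    _ ≤ 1 * exp (-1 * u) := by gcongr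
    _ = _ := one_mul _

lemma image_exp_sub {a : ℝ} (ha : 0 < a) :
    (fun u => exp u - a) '' Set.Ioi (log (1 + a)) = Set.Ioi 1 := by
  ext x
  constructor
  · rintro ⟨u, hu, rfl⟩
    have := (log_lt_iff_lt_exp (by linarith)).1 (Set.mem_Ioi.1 hu)
    simp only [Set.mem_Ioi]
    linarith
  · intro hx
    have hx1 : (1 : ℝ) < x := hx
    refine ⟨log (x + a), log_lt_log (by linarith) (by linarith), ?_⟩
    simp only
    rw [exp_log (by linarith)]
    ring

lemma hasDerivAt_exp_sub (a u : ℝ) : HasDerivAt (fun u => exp u - a) (exp u) u :=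
  (hasDerivAt_exp u).sub_const a

lemma injOn_exp_sub (a : ℝ) (s : Set ℝ) : Set.InjOn (fun u => exp u - a) s :=
  fun x _ y _ h => exp_injective (by simpa using h)

lemma abs_exp_smul_eq (α a u : ℝ) (c : ℝ → ℝ) :
    |exp u| • (c (exp u - a) * (log (exp u - a + a) ^ (α - 2) / (exp u - a + a) ^ 3 *
      (α * (α - 1) - 3 * α * log (exp u - a + a) + 2 * log (exp u - a + a) ^ 2)))
      = c (exp u - a) * stieltjesKernelReal α u := by
  rw [sub_add_cancel, log_exp, abs_of_pos (exp_pos u), smul_eq_mul, stieltjesKernelReal,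
    show -2 * u = -(u + u) by ring, exp_neg, exp_add]
  have := (exp_pos u).ne'
  field_simp

lemma integral_comp_log (α : ℝ) {a : ℝ} (ha : 0 < a) (c : ℝ → ℝ) :
    ∫ x in Set.Ioi 1, c x * (log (x + a) ^ (α - 2) / (x + a) ^ 3 *
      (α * (α - 1) - 3 * α * log (x + a) + 2 * log (x + a) ^ 2))
      = ∫ u in Set.Ioi (log (1 + a)), c (exp u - a) * stieltjesKernelReal α u := by
  rw [← image_exp_sub ha, integral_image_eq_integral_abs_deriv_smul measurableSet_Ioi
    (fun u _ => (hasDerivAt_exp_sub a u).hasDerivWithinAt) (injOn_exp_sub a _)]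
  simp only [abs_exp_smul_eq]

lemma integrableOn_second_deriv {α a : ℝ} (hα : 2 ≤ α) (ha : 0 < a) :
    IntegrableOn (fun x => log (x + a) ^ (α - 2) / (x + a) ^ 3 *
      (α * (α - 1) - 3 * α * log (x + a) + 2 * log (x + a) ^ 2)) (Set.Ioi 1) := by
  rw [← image_exp_sub ha, integrableOn_image_iff_integrableOn_abs_deriv_smul measurableSet_Ioi
    (fun u _ => (hasDerivAt_exp_sub a u).hasDerivWithinAt) (injOn_exp_sub a _)]
  have h := abs_exp_smul_eq α a (c := fun _ => 1)
  simp only [one_mul] at h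
  simp only [h]
  exact integrableOn_stieltjesKernelReal hα _

lemma abs_integral_cos_le {α a E V : ℝ} {k : ℕ} (hα : 2 ≤ α) (ha : 0 < a) (ha1 : a ≤ 1)
    (hk : 1 ≤ k) (hE : 1 ≤ E) (hV : 0 < V) (hV2 : V < π / 2)
    (h : ∀ x y, 0 ≤ x → (y = V ∨ x ≤ log 2 ∧ 0 ≤ y ∧ y ≤ V) →
      exp (α * (log (x ^ 2 + y ^ 2) / 2) - 2 * π * (exp x * sin y)) ≤ E) :
    |∫ x in Set.Ioi 1, cos (2 * π * k * x) * (log (x + a) ^ (α - 2) / (x + a) ^ 3 *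
      (α * (α - 1) - 3 * α * log (x + a) + 2 * log (x + a) ^ 2))|
      ≤ (α ^ 2 + 2 * α + 2) * E * (1 / 2 + V) := by
  rw [integral_comp_log α ha (fun x => cos (2 * π * k * x))]
  have hc : 0 < log (1 + a) := log_pos (by linarith)
  have hc2 : log (1 + a) ≤ log 2 := log_le_log (by linarith) (by linarith)
  have hint : IntegrableOn (fun u => cos (2 * π * k * (exp u - a)) * stieltjesKernelReal α u)
      (Set.Ioi (log (1 + a))) := by
    refine Integrable.bdd_mul (c := 1) (integrableOn_stieltjesKernelReal hα _) ?_ ?_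
    · apply Continuous.aestronglyMeasurable; fun_prop
    · exact Eventually.of_forall fun x => abs_cos_le_one _
  have hlim := (intervalIntegral_tendsto_integral_Ioi (log (1 + a)) hint tendsto_id).abs
  have hrhs := ((((tendsto_rpow_mul_exp_atTop α).const_mul (α ^ 2 + 2 * α + 2)).mul_const V).const_add
    ((α ^ 2 + 2 * α + 2) * E * (1 / 2 + V)))
  rw [mul_zero, zero_mul, add_zero] at hrhs
  refine le_of_tendsto_of_tendsto hlim hrhs ?_
  filter_upwards [eventually_ge_atTop (log (1 + a))] with R hR
  refine le_trans ?_ (norm_integral_oscKernel_le (a := a) hα hk hE hc hc2 hV hV2 hR h)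
  have hI : IntervalIntegrable (fun u : ℝ => oscKernel α a k u) volume (log (1 + a)) R := by
    apply ContinuousOn.intervalIntegrable
    intro u hu
    rw [Set.uIcc_of_le hR] at hu
    have h0 : 0 < (u : ℂ).re := by simpa using hc.trans_le hu.1
    have h1 := (differentiableAt_oscKernel α a k h0).continuousAt
    exact (ContinuousAt.comp (f := fun u : ℝ => (u : ℂ)) h1
      Complex.continuous_ofReal.continuousAt).continuousWithinAt
  have hre : ∫ u in log (1 + a)..R, cos (2 * π * k * (exp u - a)) * stieltjesKernelReal α u
      = (∫ u in log (1 + a)..R, oscKernel α a k u).re := by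
    rw [← Complex.reCLM_apply, ← Complex.reCLM.intervalIntegral_comp_comm hI]
    refine intervalIntegral.integral_congr fun u hu => ?_
    rw [Set.uIcc_of_le hR] at hu
    exact cos_mul_stieltjesKernelReal α a k (hc.le.trans hu.1)
  simp only [id]
  rw [hre]
  exact Complex.abs_re_le_norm _

lemma abs_boundary_le {α a : ℝ} (hα : 6 ≤ α) (ha : 0 < a) (ha1 : a ≤ 1) :
    |log (1 + a) ^ α / (1 + a) - log (1 + a) ^ (α + 1) / (α + 1) - log (1 + a) ^ α / (2 * (1 + a))
        - 1 / 12 * (log (1 + a) ^ (α - 1) * (α - log (1 + a)) / (1 + a) ^ 2)|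
      ≤ 1 / 2 + α / 12 := by
  have hL0 : 0 ≤ log (1 + a) := log_nonneg (by linarith)
  have hL1 : log (1 + a) ≤ 1 := by
    have := log_le_sub_one_of_pos (show 0 < 1 + a by linarith)
    linarith
  obtain ⟨L, hL⟩ : ∃ L, L = log (1 + a) := ⟨_, rfl⟩
  rw [← hL] at hL0 hL1 ⊢
  have hp : ∀ s : ℝ, 0 ≤ s → 0 ≤ L ^ s ∧ L ^ s ≤ 1 := fun s hs =>
    ⟨rpow_nonneg hL0 s, rpow_le_one hL0 hL1 hs⟩
  have h1 := hp α (by linarith)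
  have h2 := hp (α + 1) (by linarith)
  have h3 := hp (α - 1) (by linarith)
  have e1 : L ^ α / (1 + a) - L ^ α / (2 * (1 + a)) = L ^ α / (2 * (1 + a)) := by
    field_simp; ring
  have b1 : 0 ≤ L ^ α / (2 * (1 + a)) := by have := h1.1; positivity
  have b1' : L ^ α / (2 * (1 + a)) ≤ 1 / 2 := by
    rw [div_le_iff₀ (by linarith)]; linarith [h1.2]
  have b2 : 0 ≤ L ^ (α + 1) / (α + 1) := by have := h2.1; positivity
  have b2' : L ^ (α + 1) / (α + 1) ≤ 1 / 2 := by
    rw [div_le_iff₀ (by linarith)]; linarith [h2.2]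
  have b3 : 0 ≤ L ^ (α - 1) * (α - L) / (1 + a) ^ 2 := by
    have := h3.1
    have : 0 ≤ α - L := by linarith
    positivity
  have b3' : L ^ (α - 1) * (α - L) / (1 + a) ^ 2 ≤ α := by
    rw [div_le_iff₀ (by positivity)]
    calc L ^ (α - 1) * (α - L) ≤ 1 * α := by
          have : 0 ≤ α - L := by linarith
          have := h3.2
          gcongr
          linarith
      _ = α * 1 := by ring
      _ ≤ α * (1 + a) ^ 2 := by gcongr; nlinarith
  rw [abs_le]
  constructor <;> linarith

/-- **Theorem (main bound).** For `a ∈ (0,1]` and `α ≥ 2π`, with `w t` the principal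
branch `W₀(it)` of the Lambert `W` function (the unique `w` with `0 < Im w < π/2` and
`w·e^w = i·t`), the quantity `C_α(a)` defined via the Euler–Maclaurin expression
satisfies `|C_α(a)| < α² + (3/4)·α²·log α·exp(α·Re(log w(α/2π) − 1/w(α/2π)))`. -/
theorem stieltjes_bound (a α : ℝ) (ha : a ∈ Set.Ioc (0:ℝ) 1) (hα : 2 * π ≤ α)
    (w : ℝ → ℂ)
    (hw : ∀ t : ℝ, 0 < t → 0 < (w t).im ∧ (w t).im < π / 2 ∧
      w t * Complex.exp (w t) = Complex.I * t) :
    |Real.log (1 + a) ^ α / (1 + a) - Real.log (1 + a) ^ (α + 1) / (α + 1)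
        - Real.log (1 + a) ^ α / (2 * (1 + a))
        - 1 / 12 * (Real.log (1 + a) ^ (α - 1) * (α - Real.log (1 + a)) / (1 + a) ^ 2)
        - ∫ x in Set.Ioi (1:ℝ),
            (Int.fract x ^ 2 - Int.fract x + 1 / 6) *
              (Real.log (x + a) ^ (α - 2) / (x + a) ^ 3 *
                (α * (α - 1) - 3 * α * Real.log (x + a) + 2 * Real.log (x + a) ^ 2))|
      < α ^ 2 + 3 / 4 * α ^ 2 * Real.log α *
          Real.exp (α * (Complex.log (w (α / (2 * π))) - 1 / w (α / (2 * π))).re) := by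
  obtain ⟨ha0, ha1⟩ := ha
  have hα6 : 6 ≤ α := by linarith [pi_gt_three]
  obtain ⟨V, hV, hV2, hcontour⟩ := exists_contour (show 0 < α by linarith) hw
  rw [show (Complex.log (w (α / (2 * π))) - 1 / w (α / (2 * π))).re
    = lambertRate (w (α / (2 * π))) from rfl]
  obtain ⟨E, hE⟩ : ∃ E, E = exp (α * lambertRate (w (α / (2 * π)))) := ⟨_, rfl⟩
  rw [← hE] at hcontour ⊢
  have hE0 : 0 < E := hE ▸ exp_pos _
  have hint := abs_integral_fract_mul_le (integrableOn_second_deriv (by linarith) ha0)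
    fun k hk => abs_integral_cos_le (by linarith) ha0 ha1 hk (by linarith) hV hV2 hcontour
  have hbd := abs_boundary_le hα6 ha0 ha1
  have hlog : 1 ≤ log α := by
    rw [le_log_iff_exp_le (by linarith)]
    linarith [exp_one_lt_d9]
  refine (abs_sub _ _).trans_lt ((add_le_add hbd hint).trans_lt ?_)
  have hpoly : α ^ 2 + 2 * α + 2 ≤ 25 / 18 * α ^ 2 := by nlinarith
  have hV3 : 1 / 2 + V ≤ 2.08 := by linarith [pi_lt_d2]
  have hmain : (α ^ 2 + 2 * α + 2) * (1 + E) * (1 / 2 + V) ≤ 25 / 18 * α ^ 2 * (1 + E) * 2.08 := by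
    gcongr
  have hlogE : 3 / 4 * α ^ 2 * 1 * E ≤ 3 / 4 * α ^ 2 * log α * E := by gcongr
  have hαE : 0 < α ^ 2 * E := by positivity
  norm_num at hmain
  nlinarith
end

section
/- For every t > 0, writing I = Im(w(t)), one has Re(w(t)) = I·tan(I) and (I/cos I)·exp(I·tan I) = t. In other words, the map t ↦ Im(w(t)) on (0,∞) is inverted by the function T(y) = (y/cos y)·e^{y·tan y} on (0, π/2). -/
open Real

/-- **Lemma 1.** For `t > 0`, writing `I = Im(w(t))` for `w t = W₀(it)`, one has
`Re(w(t)) = I·tan I` and `(I/cos I)·e^{I·tan I} = t`; that is, `t ↦ Im(w(t))` is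
inverted by `T(y) = (y/cos y)·e^{y·tan y}`. -/
theorem lambert_im_inverse
    (w : ℝ → ℂ)
    (hw : ∀ t : ℝ, 0 < t → 0 < (w t).im ∧ (w t).im < π / 2 ∧
      w t * Complex.exp (w t) = Complex.I * t) :
    ∀ t : ℝ, 0 < t →
      (w t).re = (w t).im * Real.tan (w t).im ∧
      (w t).im / Real.cos (w t).im * Real.exp ((w t).im * Real.tan (w t).im) = t := by
  intro t ht
  obtain ⟨hpos, hlt, h⟩ := hw t ht
  have hc : 0 < Real.cos (w t).im := Real.cos_pos_of_mem_Ioo ⟨by linarith, hlt⟩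
  have hre := congrArg Complex.re h
  have him := congrArg Complex.im h
  simp only [Complex.mul_re, Complex.mul_im, Complex.exp_re, Complex.exp_im, Complex.I_re,
    Complex.I_im, Complex.ofReal_re, Complex.ofReal_im] at hre him
  have hx : (w t).re = (w t).im * Real.tan (w t).im := by
    have hmul : Real.exp (w t).re *
        ((w t).re * Real.cos (w t).im - (w t).im * Real.sin (w t).im) = 0 := by
      linear_combination hre
    have hsub := (mul_eq_zero.mp hmul).resolve_left (Real.exp_pos _).ne'
    rw [Real.tan_eq_sin_div_cos, ← mul_div_assoc, eq_div_iff hc.ne']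
    exact sub_eq_zero.mp hsub
  refine ⟨hx, ?_⟩
  have hxc : (w t).re * Real.cos (w t).im = (w t).im * Real.sin (w t).im := by
    rw [hx, mul_assoc, Real.tan_mul_cos hc.ne']
  rw [← hx, div_mul_eq_mul_div, div_eq_iff hc.ne']
  linear_combination Real.cos (w t).im * him
    - Real.exp (w t).re * Real.sin (w t).im * hxc
    - (w t).im * Real.exp (w t).re * Real.sin_sq_add_cos_sq (w t).im
end

section
/- For every real t > 0 there exists exactly one complex number w with 0 < Im(w) < π/2 satisfying w·exp(w) = i·t. -/
open Real

/-- On the strip `0 < Im w < π / 2`, the equation `w * exp w = I * t` reduces to a real equation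
in `Im w`, together with an explicit formula for `Re w`. -/
lemma mul_exp_eq_I_mul_iff {w : ℂ} (t : ℝ) (h0 : 0 < w.im) (h1 : w.im < π / 2) :
    w * Complex.exp w = Complex.I * t ↔
      w.re = w.im * tan w.im ∧ exp (w.im * tan w.im) * (w.im / cos w.im) = t := by
  have hc : 0 < cos w.im := cos_pos_of_mem_Ioo ⟨by linarith, h1⟩
  have hre : w.re * cos w.im - w.im * sin w.im = 0 ↔ w.re = w.im * tan w.im := by
    rw [tan_eq_sin_div_cos, ← mul_div_assoc, eq_div_iff hc.ne', sub_eq_zero]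
  have him : w.im * tan w.im * sin w.im + w.im * cos w.im = w.im / cos w.im := by
    rw [tan_eq_sin_div_cos]
    field_simp
    linear_combination sin_sq_add_cos_sq w.im
  have key : w * Complex.exp w = Complex.I * t ↔
      w.re * cos w.im - w.im * sin w.im = 0 ∧
        exp w.re * (w.re * sin w.im + w.im * cos w.im) = t := by
    rw [Complex.ext_iff]
    simp only [Complex.mul_re, Complex.mul_im, Complex.exp_re, Complex.exp_im, Complex.I_re,
      Complex.I_im, Complex.ofReal_re, Complex.ofReal_im]
    refine and_congr ?_ ?_
    · rw [show w.re * (exp w.re * cos w.im) - w.im * (exp w.re * sin w.im) =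
        exp w.re * (w.re * cos w.im - w.im * sin w.im) by ring]
      simp [(exp_pos w.re).ne']
    · rw [show w.re * (exp w.re * sin w.im) + w.im * (exp w.re * cos w.im) =
        exp w.re * (w.re * sin w.im + w.im * cos w.im) by ring]
      simp
  rw [key, hre]
  refine and_congr_right fun h => ?_
  rw [h, him]

lemma strictMonoOn_exp_mul_tan_mul_div_cos :
    StrictMonoOn (fun y : ℝ => exp (y * tan y) * (y / cos y)) (Set.Ico 0 (π / 2)) := by
  intro a ha b hb hab
  have hcb : 0 < cos b := cos_pos_of_mem_Ioo ⟨by linarith [ha.1, pi_pos], hb.2⟩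
  have hcos : cos b < cos a := cos_lt_cos_of_nonneg_of_le_pi_div_two ha.1 hb.2.le hab
  have htan : tan a < tan b :=
    tan_lt_tan_of_lt_of_lt_pi_div_two (by linarith [ha.1, pi_pos]) hb.2 hab
  have hta : 0 ≤ tan a := tan_nonneg_of_nonneg_of_le_pi_div_two ha.1 ha.2.le
  have hexp : exp (a * tan a) ≤ exp (b * tan b) :=
    exp_le_exp.2 (mul_le_mul hab.le htan.le hta hb.1)
  have hdiv : a / cos a < b / cos b := div_lt_div₀ hab hcos.le hb.1 hcb
  exact mul_lt_mul_of_le_of_lt_of_nonneg_of_pos hexp hdiv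
    (div_nonneg ha.1 (hcb.trans hcos).le) (exp_pos _)

lemma exists_exp_mul_tan_mul_div_cos_eq {t : ℝ} (ht : 0 < t) :
    ∃ y : ℝ, 0 < y ∧ y < π / 2 ∧ exp (y * tan y) * (y / cos y) = t := by
  obtain ⟨b, hb, hbt⟩ : ∃ b ∈ Set.Ioo 0 (π / 2), b - t * cos b = 0 :=
    intermediate_value_Ioo pi_div_two_pos.le (f := fun b => b - t * cos b)
      (by fun_prop) ⟨by simpa using ht, by simpa using pi_pos⟩
  have hcos : ∀ y ∈ Set.Icc 0 b, cos y ≠ 0 := fun y hy =>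
    (cos_pos_of_mem_Ioo ⟨by linarith [hy.1, pi_pos], hy.2.trans_lt hb.2⟩).ne'
  have hcont : ContinuousOn (fun y : ℝ => exp (y * tan y) * (y / cos y)) (Set.Icc 0 b) := by
    have htan : ContinuousOn tan (Set.Icc 0 b) := continuousOn_tan.mono hcos
    exact (continuousOn_id.mul htan).rexp.mul (continuousOn_id.div continuousOn_cos hcos)
  have hle : t ≤ exp (b * tan b) * (b / cos b) := by
    have hdiv : b / cos b = t := by
      rw [div_eq_iff (hcos b ⟨hb.1.le, le_rfl⟩)]
      linarith
    rw [hdiv]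
    exact le_mul_of_one_le_left ht.le (one_le_exp
      (mul_nonneg hb.1.le (tan_nonneg_of_nonneg_of_le_pi_div_two hb.1.le hb.2.le)))
  obtain ⟨y, hy, hyt⟩ := intermediate_value_Ioc hb.1.le hcont ⟨by simpa using ht, hle⟩
  exact ⟨y, hy.1, hy.2.trans_lt hb.2, hyt⟩

/-- **Existence and uniqueness of `W₀(it)`.** For every real `t > 0` there exists exactly
one complex number `w` with `0 < Im w < π/2` satisfying `w·e^w = i·t`. -/
theorem lambert_exists_unique (t : ℝ) (ht : 0 < t) :
    ∃! w : ℂ, (0 < w.im ∧ w.im < π / 2) ∧ w * Complex.exp w = Complex.I * t := by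
  obtain ⟨y, h0, h1, hy⟩ := exists_exp_mul_tan_mul_div_cos_eq ht
  refine ⟨⟨y * tan y, y⟩, ⟨⟨h0, h1⟩, (mul_exp_eq_I_mul_iff t h0 h1).2 ⟨rfl, hy⟩⟩, ?_⟩
  rintro w ⟨⟨hw0, hw1⟩, hw⟩
  obtain ⟨hre, him⟩ := (mul_exp_eq_I_mul_iff t hw0 hw1).1 hw
  have hwy : w.im = y := strictMonoOn_exp_mul_tan_mul_div_cos.injOn ⟨hw0.le, hw1⟩ ⟨h0.le, h1⟩
    (him.trans hy.symm)
  exact Complex.ext (by rw [hre, hwy]) hwy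
end

section
/- The function t ↦ Im(w(t)) is strictly increasing on (0, ∞), satisfies 0 < Im(w(t)) < π/2 for all t > 0, and Im(w(t)) → π/2 as t → ∞. -/
open Real

/-- The parameter `t` of a solution of `z * exp z = I * t` as a function of `z.im`. -/
noncomputable def lambertParam (v : ℝ) : ℝ := v / cos v * exp (v * tan v)

lemma monotoneOn_lambertParam : MonotoneOn lambertParam (Set.Ioo 0 (π / 2)) := by
  intro a ha b hb hab
  have hca : 0 < cos a := cos_pos_of_mem_Ioo ⟨by linarith [ha.1, pi_pos], ha.2⟩
  have hcb : 0 < cos b := cos_pos_of_mem_Ioo ⟨by linarith [hb.1, pi_pos], hb.2⟩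
  have hcos : cos b ≤ cos a :=
    cos_le_cos_of_nonneg_of_le_pi ha.1.le (by linarith [hb.2, pi_pos]) hab
  have hta : 0 ≤ tan a := tan_nonneg_of_nonneg_of_le_pi_div_two ha.1.le ha.2.le
  have htan : tan a ≤ tan b :=
    strictMonoOn_tan.monotoneOn ⟨by linarith [ha.1, pi_pos], ha.2⟩
      ⟨by linarith [hb.1, pi_pos], hb.2⟩ hab
  have hb0 : 0 ≤ b := hb.1.le
  unfold lambertParam
  gcongr

lemma lambertParam_im_eq {z : ℂ} {t : ℝ} (h0 : 0 < z.im) (h1 : z.im < π / 2)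
    (hz : z * Complex.exp z = Complex.I * t) : lambertParam z.im = t := by
  have hc : 0 < cos z.im := cos_pos_of_mem_Ioo ⟨by linarith [pi_pos], h1⟩
  have hre := congrArg Complex.re hz
  have him := congrArg Complex.im hz
  simp only [Complex.mul_re, Complex.mul_im, Complex.exp_re, Complex.exp_im, Complex.I_re,
    Complex.I_im, Complex.ofReal_re, Complex.ofReal_im] at hre him
  have hu : z.re * cos z.im = z.im * sin z.im := by
    refine mul_left_cancel₀ (exp_pos z.re).ne' ?_
    linarith
  have hu' : z.im * tan z.im = z.re := by
    rw [tan_eq_sin_div_cos]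
    field_simp
    linarith
  have hv : z.im / cos z.im = z.re * sin z.im + z.im * cos z.im := by
    rw [div_eq_iff hc.ne']
    linear_combination (-sin z.im) * hu - z.im * sin_sq_add_cos_sq z.im
  rw [lambertParam, hu', hv]
  linarith

/-- **Monotonicity and limit of `Im(w(t))`.** The function `t ↦ Im(w(t))` is strictly
increasing on `(0,∞)`, satisfies `0 < Im(w(t)) < π/2` for all `t > 0`, and tends to
`π/2` as `t → ∞`. -/
theorem lambert_im_mono
    (w : ℝ → ℂ)
    (hw : ∀ t : ℝ, 0 < t → 0 < (w t).im ∧ (w t).im < π / 2 ∧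
      w t * Complex.exp (w t) = Complex.I * t) :
    StrictMonoOn (fun t : ℝ => (w t).im) (Set.Ioi (0:ℝ)) ∧
    (∀ t : ℝ, 0 < t → 0 < (w t).im ∧ (w t).im < π / 2) ∧
    Filter.Tendsto (fun t : ℝ => (w t).im) Filter.atTop (nhds (π / 2)) := by
  have hmem (t : ℝ) (ht : 0 < t) : (w t).im ∈ Set.Ioo 0 (π / 2) := ⟨(hw t ht).1, (hw t ht).2.1⟩
  have hparam (t : ℝ) (ht : 0 < t) : lambertParam (w t).im = t :=
    lambertParam_im_eq (hw t ht).1 (hw t ht).2.1 (hw t ht).2.2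
  refine ⟨fun s hs t ht hst => ?_, hmem, ?_⟩
  · refine lt_of_not_ge fun h => hst.not_ge ?_
    have := monotoneOn_lambertParam (hmem t ht) (hmem s hs) h
    rwa [hparam t ht, hparam s hs] at this
  · refine tendsto_order.2 ⟨fun a ha => ?_, fun a ha => ?_⟩
    · filter_upwards [Filter.eventually_gt_atTop 0,
        Filter.eventually_gt_atTop (lambertParam a)] with t ht hat
      refine lt_of_not_ge fun h => hat.not_ge ?_
      have := monotoneOn_lambertParam (hmem t ht) ⟨(hmem t ht).1.trans_le h, ha⟩ h
      rwa [hparam t ht] at this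
    · filter_upwards [Filter.eventually_gt_atTop 0] with t ht
      exact (hmem t ht).2.trans ha
end

section
/- For every t > 0, one has Re(w(t)) = Im(w(t))·tan(Im(w(t))) > 0. -/
open Real

/-- For every `t > 0`, `Re(w(t)) = Im(w(t))·tan(Im(w(t))) > 0`, where `w t = W₀(it)`. -/
theorem lambert_re_pos
    (w : ℝ → ℂ)
    (hw : ∀ t : ℝ, 0 < t → 0 < (w t).im ∧ (w t).im < π / 2 ∧
      w t * Complex.exp (w t) = Complex.I * t) :
    ∀ t : ℝ, 0 < t →
      (w t).re = (w t).im * Real.tan (w t).im ∧ 0 < (w t).re := by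
  intro t ht
  obtain ⟨him, him', heq⟩ := hw t ht
  have hcos : 0 < Real.cos (w t).im := Real.cos_pos_of_mem_Ioo ⟨by linarith, him'⟩
  have hre := congrArg Complex.re heq
  simp only [Complex.mul_re, Complex.exp_re, Complex.exp_im, Complex.I_re, Complex.I_im,
    Complex.ofReal_re, Complex.ofReal_im, zero_mul, mul_zero, sub_zero] at hre
  have hbalance : (w t).re * Real.cos (w t).im = (w t).im * Real.sin (w t).im :=
    mul_left_cancel₀ (Real.exp_ne_zero (w t).re) (by linear_combination hre)
  have htan : (w t).re = (w t).im * Real.tan (w t).im := by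
    rw [Real.tan_eq_sin_div_cos, ← mul_div_assoc, eq_div_iff hcos.ne', hbalance]
  exact ⟨htan, htan ▸ mul_pos him (Real.tan_pos_of_pos_of_lt_pi_div_two him him')⟩
end

section
/- The function t ↦ Re(log(w(t)) − 1/w(t)) is strictly increasing on (0, ∞): for all 0 < t₁ < t₂ one has Re(log(w(t₁)) − 1/w(t₁)) < Re(log(w(t₂)) − 1/w(t₂)). Here log denotes the principal complex logarithm. -/
open Real

/-- A point `w` with `w * exp w` on the positive imaginary axis is determined by its imaginary
part `y`: it has `w.re = y * tan y`. -/
lemma lambert_re_eq {w : ℂ} {t : ℝ} (h1 : 0 < w.im) (h2 : w.im < π / 2)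
    (h : w * Complex.exp w = Complex.I * t) : w.re = w.im * tan w.im := by
  have hc : 0 < cos w.im := cos_pos_of_mem_Ioo ⟨by linarith, h2⟩
  have hre := congrArg Complex.re h
  simp only [Complex.mul_re, Complex.exp_re, Complex.exp_im, Complex.I_re, Complex.I_im,
    Complex.ofReal_re, Complex.ofReal_im] at hre
  have : exp w.re * (w.re * cos w.im - w.im * sin w.im) = 0 := by linarith
  have := (mul_eq_zero.mp this).resolve_left (exp_pos _).ne'
  rw [tan_eq_sin_div_cos]
  field_simp
  linarith

lemma lambert_arg_eq {w : ℂ} {t : ℝ} (h1 : 0 < w.im) (h2 : w.im < π / 2)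
    (h : w * Complex.exp w = Complex.I * t) :
    t = exp (w.im * tan w.im) * (w.im / cos w.im) := by
  have hc : 0 < cos w.im := cos_pos_of_mem_Ioo ⟨by linarith, h2⟩
  have him := congrArg Complex.im h
  simp only [Complex.mul_im, Complex.exp_re, Complex.exp_im, Complex.I_re, Complex.I_im,
    Complex.ofReal_re, Complex.ofReal_im, lambert_re_eq h1 h2 h] at him
  have key : w.im * tan w.im * sin w.im + w.im * cos w.im = w.im / cos w.im := by
    rw [tan_eq_sin_div_cos]
    field_simp
    exact sin_sq_add_cos_sq _
  rw [← key]
  linarith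

lemma re_log_sub_inv_eq {w : ℂ} (h1 : 0 < w.im) (h2 : w.im < π / 2)
    (hx : w.re = w.im * tan w.im) :
    (Complex.log w - 1 / w).re =
      log (w.im / cos w.im) - sin (2 * w.im) / (2 * w.im) := by
  have hc : 0 < cos w.im := cos_pos_of_mem_Ioo ⟨by linarith, h2⟩
  have hsq : Complex.normSq w = (w.im / cos w.im) ^ 2 := by
    rw [Complex.normSq_apply, hx, tan_eq_sin_div_cos]
    field_simp
    exact sin_sq_add_cos_sq _
  have hn : ‖w‖ = w.im / cos w.im := by
    rw [← sq_eq_sq₀ (norm_nonneg _) (by positivity), ← Complex.normSq_eq_norm_sq, hsq]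
  rw [Complex.sub_re, Complex.log_re, hn, one_div, Complex.inv_re, hsq, hx,
    tan_eq_sin_div_cos, sin_two_mul]
  field_simp

lemma div_cos_lt_div_cos {a b : ℝ} (ha : 0 < a) (hab : a < b) (hb : b < π / 2) :
    a / cos a < b / cos b :=
  div_lt_div₀ hab (cos_le_cos_of_nonneg_of_le_pi ha.le (by linarith) hab.le) (by linarith)
    (cos_pos_of_mem_Ioo ⟨by linarith, hb⟩)

lemma exp_mul_tan_mul_div_cos_lt {a b : ℝ} (ha : 0 < a) (hab : a < b) (hb : b < π / 2) :
    exp (a * tan a) * (a / cos a) < exp (b * tan b) * (b / cos b) := by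
  have hca : 0 < cos a := cos_pos_of_mem_Ioo ⟨by linarith, by linarith⟩
  have ht : tan a < tan b := tan_lt_tan_of_nonneg_of_lt_pi_div_two ha.le hb hab
  have hta : 0 < tan a := tan_pos_of_pos_of_lt_pi_div_two ha (by linarith)
  have hd := div_cos_lt_div_cos ha hab hb
  have hp : a * tan a < b * tan b := by gcongr
  exact mul_lt_mul'' (exp_lt_exp.mpr hp) hd (exp_pos _).le (by positivity)

lemma sin_div_lt_sin_div {a b : ℝ} (ha : 0 < a) (hab : a < b) (hb : b ≤ π) :
    sin b / b < sin a / a := by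
  simpa using strictConcaveOn_sin_Icc.secant_strict_mono (a := 0) (x := a) (y := b)
    ⟨le_rfl, pi_pos.le⟩ ⟨ha.le, by linarith⟩ ⟨by linarith, hb⟩ ha.ne' (by linarith) hab

/-- **Lemma 2.** The function `t ↦ Re(log(w(t)) − 1/w(t))` is strictly increasing on
`(0,∞)`, where `w t = W₀(it)` and `log` is the principal complex logarithm. -/
theorem lambert_re_log_sub_inv_mono
    (w : ℝ → ℂ)
    (hw : ∀ t : ℝ, 0 < t → 0 < (w t).im ∧ (w t).im < π / 2 ∧
      w t * Complex.exp (w t) = Complex.I * t) :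
    ∀ t₁ t₂ : ℝ, 0 < t₁ → t₁ < t₂ →
      (Complex.log (w t₁) - 1 / w t₁).re < (Complex.log (w t₂) - 1 / w t₂).re := by
  intro t₁ t₂ ht₁ ht
  obtain ⟨p₁, q₁, e₁⟩ := hw t₁ ht₁
  obtain ⟨p₂, q₂, e₂⟩ := hw t₂ (ht₁.trans ht)
  have hlt : (w t₁).im < (w t₂).im := by
    by_contra! hle
    have a₁ := lambert_arg_eq p₁ q₁ e₁
    have a₂ := lambert_arg_eq p₂ q₂ e₂
    rcases hle.lt_or_eq with hlt | heq
    · linarith [exp_mul_tan_mul_div_cos_lt p₂ hlt q₁]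
    · rw [heq] at a₂
      linarith
  rw [re_log_sub_inv_eq p₁ q₁ (lambert_re_eq p₁ q₁ e₁),
    re_log_sub_inv_eq p₂ q₂ (lambert_re_eq p₂ q₂ e₂)]
  have hc₁ : 0 < cos (w t₁).im := cos_pos_of_mem_Ioo ⟨by linarith, q₁⟩
  have hlog := log_lt_log (div_pos p₁ hc₁) (div_cos_lt_div_cos p₁ hlt q₂)
  have hsin := sin_div_lt_sin_div (a := 2 * (w t₁).im) (b := 2 * (w t₂).im)
    (by linarith) (by linarith) (by linarith)
  linarith
end

section
/- For every positive integer k and every real α ≥ 2π, one has k·sin(Im(w(α/(2πk)))) ≥ 1/2. -/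
open Real

/-- If `z * exp z = i t`, then `Re z * cos (Im z) = Im z * sin (Im z)` and
`t * cos (Im z) = exp (Re z) * Im z`. -/
lemma re_mul_cos_and_mul_cos_of_mul_exp_eq {z : ℂ} {t : ℝ}
    (h : z * Complex.exp z = Complex.I * t) :
    z.re * cos z.im = z.im * sin z.im ∧ t * cos z.im = exp z.re * z.im := by
  have hre := congrArg Complex.re h
  have him := congrArg Complex.im h
  simp only [Complex.mul_re, Complex.mul_im, Complex.exp_re, Complex.exp_im, Complex.I_re,
    Complex.I_im, Complex.ofReal_re, Complex.ofReal_im] at hre him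
  have hx : z.re * cos z.im = z.im * sin z.im := by
    apply mul_left_cancel₀ (exp_pos z.re).ne'
    linarith
  refine ⟨hx, ?_⟩
  linear_combination (-cos z.im) * him + exp z.re * sin z.im * hx +
    exp z.re * z.im * sin_sq_add_cos_sq z.im

/-- On `(0, π / 6)`, the curve `x cos y = y sin y` satisfies `y exp x ≤ 2 sin y cos y`. -/
lemma exp_mul_le_two_mul_sin_mul_cos {x y : ℝ} (hy : 0 < y) (hy' : y < π / 6)
    (hxy : x * cos y = y * sin y) : exp x * y ≤ 2 * sin y * cos y := by
  have hy1 : y < 0.53 := by linarith [pi_lt_d2]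
  have hy2 : y ^ 2 < 0.2809 := by nlinarith
  have hc : 0.8595 ≤ cos y := by linarith [one_sub_sq_div_two_le_cos (x := y)]
  have hs : 0.92 * y ≤ sin y := by
    have := sin_gt_sub_cube hy
    nlinarith
  have hx : x ≤ 1 / 3 := by
    by_contra! hlt
    nlinarith [sin_lt hy]
  have he : exp x ≤ 3 / 2 := by
    have h1 : 1 - x ≤ exp (-x) := by linarith [add_one_le_exp (-x)]
    have h2 : exp x * exp (-x) = 1 := by rw [← exp_add]; simp
    nlinarith [exp_pos x]
  nlinarith

/-- **Lemma 3.** For every positive integer `k` and every real `α ≥ 2π`,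
`k·sin(Im(w(α/(2πk)))) ≥ 1/2`, where `w t = W₀(it)`. -/
theorem lambert_sin_bound
    (w : ℝ → ℂ)
    (hw : ∀ t : ℝ, 0 < t → 0 < (w t).im ∧ (w t).im < π / 2 ∧
      w t * Complex.exp (w t) = Complex.I * t) :
    ∀ (k : ℕ), 0 < k → ∀ (α : ℝ), 2 * π ≤ α →
      (1 : ℝ) / 2 ≤ k * Real.sin ((w (α / (2 * π * k))).im) := by
  intro k hk α hα
  have hk1 : (1 : ℝ) ≤ k := by exact_mod_cast hk
  have hα0 : 0 < α := by linarith [pi_pos]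
  have htk : 1 ≤ k * (α / (2 * π * k)) := by
    have : k * (α / (2 * π * k)) = α / (2 * π) := by field_simp
    rw [this, one_le_div (by positivity)]
    exact hα
  have ht : 0 < α / (2 * π * k) := by positivity
  generalize α / (2 * π * k) = t at ht htk ⊢
  obtain ⟨hy, hy', h⟩ := hw t ht
  obtain ⟨hx, htc⟩ := re_mul_cos_and_mul_cos_of_mul_exp_eq h
  by_contra! hlt
  have hs : 0 < sin (w t).im := sin_pos_of_pos_of_lt_pi hy (by linarith [pi_pos])
  have hc : 0 < cos (w t).im := cos_pos_of_mem_Ioo ⟨by linarith, hy'⟩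
  have hy6 : (w t).im < π / 6 := by
    by_contra! hle
    have := sin_le_sin_of_le_of_le_pi_div_two (by linarith [pi_pos]) hy'.le hle
    rw [sin_pi_div_six] at this
    nlinarith
  have hle := exp_mul_le_two_mul_sin_mul_cos hy hy6 hx
  rw [← htc] at hle
  have := le_of_mul_le_mul_right hle hc
  nlinarith
end

section
/- For every positive integer k, one has T(arcsin(1/(2k))) < 1/k, where T(y) = (y/cos y)·e^{y·tan y}. -/
open Real

theorem mul_exp_mul_tan_lt_two_mul_sin {y : ℝ} (hy0 : 0 < y) (hy : y ≤ π / 6) :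
    y / Real.cos y * Real.exp (y * Real.tan y) < 2 * Real.sin y := by
  have hy1 : y < 0.53 := by linarith [Real.pi_lt_d2]
  have hs0 : 0 < Real.sin y := Real.sin_pos_of_pos_of_lt_pi hy0 (by linarith [Real.pi_pos])
  have hs1 : Real.sin y ≤ 1 / 2 := by
    rw [← Real.sin_pi_div_six]
    exact Real.sin_le_sin_of_le_of_le_pi_div_two (by linarith [Real.pi_pos])
      (by linarith [Real.pi_pos]) hy
  have hc0 : 0 < Real.cos y := Real.cos_pos_of_mem_Ioo ⟨by linarith [Real.pi_pos],
    by linarith [Real.pi_pos]⟩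
  have hc : 0.86 < Real.cos y := by nlinarith [Real.sin_sq_add_cos_sq y]
  have hsin : 0.92 * y < Real.sin y := by
    have h := Real.sin_gt_sub_cube hy0
    nlinarith [mul_pos hy0 hy0]
  have ht : Real.tan y < 0.59 := by
    rw [Real.tan_eq_sin_div_cos, div_lt_iff₀ hc0]
    linarith
  have hyt : y * Real.tan y < 0.32 := by nlinarith
  have hexp : Real.exp (y * Real.tan y) < 1.5 := by
    have h1 := Real.add_one_le_exp (-(y * Real.tan y))
    rw [Real.exp_neg] at h1
    have h2 : Real.exp (y * Real.tan y) * (Real.exp (y * Real.tan y))⁻¹ = 1 :=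
      mul_inv_cancel₀ (Real.exp_pos _).ne'
    nlinarith [Real.exp_pos (y * Real.tan y)]
  rw [div_mul_eq_mul_div, div_lt_iff₀ hc0]
  calc y * Real.exp (y * Real.tan y) < y * 1.5 := by gcongr
    _ < 2 * Real.sin y * Real.cos y := by nlinarith

/-- For every positive integer `k`, `T(arcsin(1/(2k))) < 1/k`, where
`T(y) = (y/cos y)·e^{y·tan y}`. -/
theorem T_arcsin_bound (k : ℕ) (hk : 0 < k) :
    Real.arcsin (1 / (2 * k)) / Real.cos (Real.arcsin (1 / (2 * k))) *
        Real.exp (Real.arcsin (1 / (2 * k)) * Real.tan (Real.arcsin (1 / (2 * k))))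
      < 1 / k := by
  have hk1 : (1 : ℝ) ≤ k := by exact_mod_cast hk
  have hs0 : (0 : ℝ) < 1 / (2 * k) := by positivity
  have hs1 : (1 : ℝ) / (2 * k) ≤ 1 / 2 :=
    one_div_le_one_div_of_le (by norm_num) (by linarith)
  have hle : Real.arcsin (1 / (2 * k)) ≤ π / 6 := by
    rw [Real.arcsin_le_iff_le_sin ⟨by linarith, by linarith⟩
      ⟨by linarith [Real.pi_pos], by linarith [Real.pi_pos]⟩, Real.sin_pi_div_six]
    exact hs1
  refine (mul_exp_mul_tan_lt_two_mul_sin (Real.arcsin_pos.2 hs0) hle).trans_eq ?_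
  rw [Real.sin_arcsin (by linarith) (by linarith)]
  field_simp
end

section
/- For every real α ≥ 2π, one has exp(α·Re(log(w(α/(2π))) − 1/w(α/(2π)))) < (log α)^α, where log on complex arguments denotes the principal complex logarithm and (log α)^α is the real power rpow. -/
open Real

/-- A solution of `z * exp z = i t` in the strip `0 < Im z < π / 2` has positive real part. -/
lemma re_pos_of_mul_exp_eq_I_mul {z : ℂ} {t : ℝ} (h₀ : 0 < z.im) (h₁ : z.im < π / 2)
    (hz : z * Complex.exp z = Complex.I * t) : 0 < z.re := by
  have hre := congrArg Complex.re hz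
  simp only [Complex.mul_re, Complex.exp_re, Complex.exp_im, Complex.I_re, Complex.I_im,
    Complex.ofReal_re, Complex.ofReal_im, zero_mul, mul_zero, sub_zero] at hre
  have hcos : 0 < Real.cos z.im := Real.cos_pos_of_mem_Ioo ⟨by linarith, h₁⟩
  have hsin : 0 < Real.sin z.im := Real.sin_pos_of_pos_of_lt_pi h₀ (by linarith)
  have hexp := Real.exp_pos z.re
  have hprod : 0 < z.re * (Real.exp z.re * Real.cos z.im) := by
    have : 0 < z.im * (Real.exp z.re * Real.sin z.im) := by positivity
    linarith
  exact pos_of_mul_pos_left hprod (by positivity)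

lemma log_norm_add_re_of_mul_exp_eq_I_mul {z : ℂ} {t : ℝ} (ht : 0 < t) (h₀ : z ≠ 0)
    (hz : z * Complex.exp z = Complex.I * t) : Real.log ‖z‖ + z.re = Real.log t := by
  have h := congrArg norm hz
  rw [norm_mul, norm_mul, Complex.norm_exp, Complex.norm_I, one_mul, Complex.norm_real,
    Real.norm_of_nonneg ht.le] at h
  rw [← h, Real.log_mul (norm_ne_zero_iff.mpr h₀) (Real.exp_pos _).ne', Real.log_exp]

lemma pi_div_two_lt_log_two_pi : π / 2 < Real.log (2 * π) := by
  have hπ : 1 < Real.log π := by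
    rw [Real.lt_log_iff_exp_lt pi_pos]
    linarith [Real.exp_one_lt_d9, Real.pi_gt_d2]
  rw [Real.log_mul two_ne_zero pi_ne_zero]
  linarith [Real.log_two_gt_d9, Real.pi_lt_d2]

/-- **Comparison with Matsuoka's main term.** For every real `α ≥ 2π`,
`exp(α·Re(log(w(α/(2π))) − 1/w(α/(2π)))) < (log α)^α`, where `w t = W₀(it)`,
`log` on complex arguments is the principal complex logarithm, and the right-hand
power is the real power `rpow`. -/
theorem main_term_lt_log_pow (α : ℝ) (hα : 2 * π ≤ α)
    (w : ℝ → ℂ)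
    (hw : ∀ t : ℝ, 0 < t → 0 < (w t).im ∧ (w t).im < π / 2 ∧
      w t * Complex.exp (w t) = Complex.I * t) :
    Real.exp (α * (Complex.log (w (α / (2 * π))) - 1 / w (α / (2 * π))).re)
      < Real.log α ^ α := by
  have hπ := pi_gt_three
  have hα₀ : 0 < α := by linarith
  have ht : 1 ≤ α / (2 * π) := by rwa [one_le_div (by positivity)]
  have hlogα : Real.log α = Real.log (2 * π) + Real.log (α / (2 * π)) := by
    rw [← Real.log_mul (by positivity) (by positivity)]
    congr 1
    field_simp
  obtain ⟨him₀, him₁, hz⟩ := hw (α / (2 * π)) (by linarith)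
  generalize w (α / (2 * π)) = z at *
  have hz₀ : z ≠ 0 := fun h => by simp [h] at him₀
  have hre := re_pos_of_mul_exp_eq_I_mul him₀ him₁ hz
  have hnorm : 0 < ‖z‖ := norm_pos_iff.mpr hz₀
  have hlog := log_norm_add_re_of_mul_exp_eq_I_mul (by linarith) hz₀ hz
  have hlog2π := pi_div_two_lt_log_two_pi
  have hlt : ‖z‖ < Real.log α := by
    rw [hlogα]
    rcases le_total ‖z‖ 1 with h | h
    · linarith [Real.log_nonneg ht]
    · have htri := Complex.norm_le_abs_re_add_abs_im z
      rw [abs_of_pos hre, abs_of_pos him₀] at htri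
      linarith [Real.log_nonneg h]
  have hinv : 0 < (1 / z).re := by
    rw [one_div, Complex.inv_re]
    exact div_pos hre (Complex.normSq_pos.mpr hz₀)
  rw [Real.rpow_def_of_pos (hnorm.trans hlt), Real.exp_lt_exp, mul_comm (Real.log _),
    mul_lt_mul_iff_right₀ hα₀, Complex.sub_re, Complex.log_re]
  linarith [Real.log_lt_log hnorm hlt]
end
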